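/- Let b, c : ℕ → ℝ be sequences with b(0) = c(0) = 1, b(1), c(1) ∈ [−2, 2], satisfying the recurrences b(m+1) = b(1)·b(m) − b(m−1) and c(m+1) = c(1)·c(m) − c(m−1) for all m ≥ 1. Then the set {m ∈ ℕ : m ≥ 1, b(m)·c(m) ≠ 0} has strictly positive lower natural density. -/

import Mathlib

lemma exists_period_nonvanishing (b : ℕ → ℝ) (hb0 : b 0 = 1)
    (hbrec : ∀ m, 1 ≤ m → b (m + 1) = b 1 * b m - b (m - 1)) :
    ∃ q, 1 ≤ q ∧ ∀ k, b (k * q) ≠ 0 := by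
  have hrec : ∀ m, b (m + 2) = b 1 * b (m + 1) - b m := fun m => hbrec (m + 1) (by omega)
  by_cases h : ∃ m, b m = 0
  · obtain ⟨p, hp⟩ := h
    have hcons : ∀ m, b m ≠ 0 ∨ b (m + 1) ≠ 0 := by
      intro m
      induction m with
      | zero => left; rw [hb0]; norm_num
      | succ m ih =>
        by_contra! hcon
        obtain ⟨h1, h2⟩ := hcon
        have h3 := hrec m
        rw [show m + 1 + 1 = m + 2 from rfl] at h2
        rw [h2, h1] at h3
        have h4 : b m = 0 := by linarith
        rcases ih with h5 | h5
        · exact h5 h4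
        · exact h5 h1
    have ht : b (p + 1) ≠ 0 := (hcons p).resolve_left (fun h => h hp)
    have key : ∀ j, b (j + (p + 1)) = b (p + 1) * b j ∧
        b (j + 1 + (p + 1)) = b (p + 1) * b (j + 1) := by
      intro j
      induction j with
      | zero =>
        refine ⟨by simp [hb0], ?_⟩
        have := hrec p
        rw [hp] at this
        rw [show 0 + 1 + (p + 1) = p + 2 by omega, this]
        ring
      | succ j ih =>
        refine ⟨ih.2, ?_⟩
        have h1 := hrec (j + (p + 1))
        rw [show j + (p + 1) + 1 = j + 1 + (p + 1) by omega, ih.1, ih.2] at h1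
        rw [show j + 1 + 1 + (p + 1) = j + (p + 1) + 2 by omega, h1,
          show j + 1 + 1 = j + 2 from rfl, hrec j]
        ring
    refine ⟨p + 1, by omega, fun k => ?_⟩
    induction k with
    | zero => simp [hb0]
    | succ k ih =>
      rw [Nat.succ_mul, (key _).1]
      exact mul_ne_zero ht ih
  · push Not at h
    exact ⟨1, le_rfl, fun k => h _⟩


/-- Theorem 2 (abstracted): for two sequences satisfying the normalized Hecke
recurrence with initial values in `[-2, 2]`, the set of indices of
simultaneous non-vanishing has strictly positive lower natural density. -/
theorem simultaneous_nonvanishing_positive_lower_density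
    (b c : ℕ → ℝ) (hb0 : b 0 = 1) (hc0 : c 0 = 1)
    (hb1 : b 1 ∈ Set.Icc (-2 : ℝ) 2) (hc1 : c 1 ∈ Set.Icc (-2 : ℝ) 2)
    (hbrec : ∀ m, 1 ≤ m → b (m + 1) = b 1 * b m - b (m - 1))
    (hcrec : ∀ m, 1 ≤ m → c (m + 1) = c 1 * c m - c (m - 1)) :
    0 < Filter.liminf
      (fun N : ℕ =>
        ({m : ℕ | 1 ≤ m ∧ m ≤ N ∧ b m * c m ≠ 0}.ncard : ℝ) / N)
      Filter.atTop := by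
  obtain ⟨q, hq, hbq⟩ := exists_period_nonvanishing b hb0 hbrec
  obtain ⟨r, hr, hcr⟩ := exists_period_nonvanishing c hc0 hcrec
  obtain ⟨Q, hQdef⟩ : ∃ Q, Q = q * r := ⟨_, rfl⟩
  have hQ : 1 ≤ Q := by rw [hQdef]; exact Nat.mul_pos hq hr
  have hgood : ∀ k, b (k * Q) * c (k * Q) ≠ 0 := by
    intro k
    apply mul_ne_zero
    · rw [hQdef, show k * (q * r) = (k * r) * q by ring]; exact hbq _
    · rw [hQdef, ← mul_assoc]; exact hcr _
  have hsub : ∀ N : ℕ, {m : ℕ | 1 ≤ m ∧ m ≤ N ∧ b m * c m ≠ 0} ⊆ (Finset.Icc 1 N : Finset ℕ) := by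
    intro N m hm
    simp only [Finset.coe_Icc, Set.mem_Icc]
    exact ⟨hm.1, hm.2.1⟩
  have hupper : ∀ N : ℕ, {m : ℕ | 1 ≤ m ∧ m ≤ N ∧ b m * c m ≠ 0}.ncard ≤ N := by
    intro N
    have := Set.ncard_le_ncard (hsub N) (Finset.finite_toSet _)
    rw [Set.ncard_coe_finset, Nat.card_Icc] at this
    omega
  have hlower : ∀ N : ℕ, N / Q ≤ {m : ℕ | 1 ≤ m ∧ m ≤ N ∧ b m * c m ≠ 0}.ncard := by
    intro N
    have hinj : Function.Injective (fun k : ℕ => k * Q) :=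
      fun x y hxy => Nat.eq_of_mul_eq_mul_right hQ hxy
    have h1 : (((Finset.Icc 1 (N / Q)).image (fun k : ℕ => k * Q) : Finset ℕ) : Set ℕ) ⊆
        {m : ℕ | 1 ≤ m ∧ m ≤ N ∧ b m * c m ≠ 0} := by
      intro m hm
      rw [Finset.mem_coe, Finset.mem_image] at hm
      obtain ⟨k, hk, rfl⟩ := hm
      rw [Finset.mem_Icc] at hk
      exact ⟨Nat.mul_pos hk.1 hQ, (Nat.mul_le_mul_right Q hk.2).trans (Nat.div_mul_le_self N Q),
        hgood k⟩
    have h2 := Set.ncard_le_ncard h1 ((Finset.finite_toSet _).subset (hsub N))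
    rw [Set.ncard_coe_finset, Finset.card_image_of_injective _ hinj, Nat.card_Icc] at h2
    omega
  have hQ' : (0 : ℝ) < Q := by exact_mod_cast hQ
  refine lt_of_lt_of_le (show (0 : ℝ) < 1 / (2 * Q) by positivity) ?_
  refine Filter.le_liminf_of_le ?_ ?_
  · refine Filter.IsBoundedUnder.isCoboundedUnder_ge ?_
    refine Filter.isBoundedUnder_of ⟨1, fun N => ?_⟩
    exact div_le_one_of_le₀ (by exact_mod_cast hupper N) (Nat.cast_nonneg N)
  · filter_upwards [Filter.eventually_ge_atTop Q] with N hN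
    have hN0 : (0 : ℝ) < N := by exact_mod_cast (lt_of_lt_of_le hQ hN)
    rw [div_le_div_iff₀ (by positivity) hN0]
    have h1 : N ≤ 2 * Q * (N / Q) := by
      have h2 := Nat.div_add_mod N Q
      have h3 := Nat.mod_lt N hQ
      have h4 : 1 ≤ N / Q := (Nat.one_le_div_iff hQ).2 hN
      nlinarith
    have h5 : N ≤ {m : ℕ | 1 ≤ m ∧ m ≤ N ∧ b m * c m ≠ 0}.ncard * (2 * Q) := by
      have := Nat.mul_le_mul_left (2 * Q) (hlower N)
      linarith
    rw [one_mul]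
    exact_mod_cast h5
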